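/- arXiv:1406.5985 — 2 statements merged into one kernel-verified Lean document; each statement's English description precedes it below -/
import Mathlib

section
/- Let h₁ and h₂ be self-adjoint ℂ-linear maps of V of rank 2 with trace 0, each defining a bisector (so each B_{hᵢ} contains a point other than its focus). Then B_{h₁} = B_{h₂} (as subsets of ℙ(V)) if and only if h₂ = r·h₁ for some nonzero real number r. -/
open scoped ComplexConjugate

noncomputable section

/-- `V` is `ℂ³`. -/
abbrev V3 : Type := Fin 3 → ℂ

/-- The hermitian form of signature `(2,1)`:
`⟨x,y⟩ = x₀·conj y₀ + x₁·conj y₁ − x₂·conj y₂`. -/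
def herm (x y : V3) : ℂ := x 0 * conj (y 0) + x 1 * conj (y 1) - x 2 * conj (y 2)

/-- The complex projective plane `ℙ(V)`. -/
abbrev PV : Type := Projectivization ℂ V3

/-- The class `[v]` of a nonzero vector `v` in `ℙ(V)`. -/
def projMk (v : V3) (hv : v ≠ 0) : PV := Projectivization.mk ℂ v hv

/-- A map `h` is self-adjoint (`h* = h`) w.r.t. the hermitian form. -/
def SelfAdj (h : Module.End ℂ V3) : Prop := ∀ x y : V3, herm (h x) y = herm x (h y)

/-- The set `B_h = {[v] ∈ ℙ(V) | ⟨h v, v⟩ = 0}`. -/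
def Bset (h : Module.End ℂ V3) : Set PV :=
  {q | ∃ v : V3, ∃ hv : v ≠ 0, q = projMk v hv ∧ herm (h v) v = 0}

/-- `h` defines a bisector: self-adjoint, trace `0`, rank `2`, and `B_h` contains
a point other than the focus (i.e. a point `[v]` with `h v ≠ 0`). -/
def IsBisector (h : Module.End ℂ V3) : Prop :=
  SelfAdj h ∧ LinearMap.trace ℂ V3 h = 0 ∧
    Module.finrank ℂ (LinearMap.range h) = 2 ∧ ∃ v : V3, herm (h v) v = 0 ∧ h v ≠ 0

/-- A linear family of bisectors: an `ℝ`-subspace of self-adjoint traceless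
degenerate maps whose base contains a negative point. -/
def IsLinearFamily (W : Submodule ℝ (Module.End ℂ V3)) : Prop :=
  (∀ h ∈ W, SelfAdj h ∧ LinearMap.trace ℂ V3 h = 0 ∧ LinearMap.det h = 0) ∧
    ∃ v : V3, ∃ hv : v ≠ 0, (herm v v).re < 0 ∧ ∀ h ∈ W, herm (h v) v = 0

/-- The map `x ↦ ⟨x,p⟩·p`. -/
def wmap (p : V3) : Module.End ℂ V3 where
  toFun x := herm x p • p
  map_add' x y := by
    show herm (x + y) p • p = herm x p • p + herm y p • p
    have : herm (x + y) p = herm x p + herm y p := by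
      simp only [herm, Pi.add_apply]; ring
    rw [this, add_smul]
  map_smul' c x := by
    show herm (c • x) p • p = c • (herm x p • p)
    have : herm (c • x) p = c * herm x p := by
      simp only [herm, Pi.smul_apply, smul_eq_mul]; ring
    rw [this, mul_smul]

/-- `ℙ(U)` for a complex subspace `U`. -/
def projC (U : Submodule ℂ V3) : Set PV :=
  {q | ∃ v : V3, ∃ hv : v ≠ 0, v ∈ U ∧ q = projMk v hv}

/-- `ℙ(T)` for a real subspace `T`. -/
def projR (T : Submodule ℝ V3) : Set PV :=
  {q | ∃ v : V3, ∃ hv : v ≠ 0, v ∈ T ∧ q = projMk v hv}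

/-- An `ℝ`-plane: `ℙ(T)` for a totally real `3`-dimensional real subspace `T`
with `ℂ·T = V`. -/
def IsRealPlane (T : Submodule ℝ V3) : Prop :=
  Module.finrank ℝ T = 3 ∧ Submodule.span ℂ (T : Set V3) = ⊤ ∧
    ∀ t ∈ T, ∀ t' ∈ T, (herm t t').im = 0

/-- A geodesic: `ℙ(W₀)` for a `2`-dimensional real subspace `W₀` on which the form
is real-valued and not identically zero. -/
def IsGeodesic (W₀ : Submodule ℝ V3) : Prop :=
  Module.finrank ℝ W₀ = 2 ∧ (∀ w ∈ W₀, ∀ w' ∈ W₀, (herm w w').im = 0) ∧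
    ∃ w ∈ W₀, ∃ w' ∈ W₀, herm w w' ≠ 0

/-- The real spine `R = {[h v] | [v] ∈ B_h, h v ≠ 0}` of `B_h`. -/
def RealSpine (h : Module.End ℂ V3) : Set PV :=
  {q | ∃ v : V3, ∃ hnz : h v ≠ 0, herm (h v) v = 0 ∧ q = projMk (h v) hnz}

/-- The orthogonal complement w.r.t. the hermitian form. -/
def hermOrth (U : Submodule ℂ V3) : Submodule ℂ V3 where
  carrier := {x | ∀ u ∈ U, herm x u = 0}
  add_mem' := by
    intro a b ha hb u hu
    have h1 : herm (a + b) u = herm a u + herm b u := by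
      simp only [herm, Pi.add_apply]; ring
    rw [h1, ha u hu, hb u hu, add_zero]
  zero_mem' := by
    intro u hu
    simp [herm]
  smul_mem' := by
    intro c x hx u hu
    have h1 : herm (c • x) u = c * herm x u := by
      simp only [herm, Pi.smul_apply, smul_eq_mul]; ring
    rw [h1, hx u hu, mul_zero]

section SesquilinearForms

variable {E : Type*} [AddCommGroup E] [Module ℂ E]

/-- A hermitian form that vanishes on the isotropic vectors of another hermitian form `H` and on
the plane spanned by a hyperbolic pair of `H` vanishes on all vectors. -/
lemma sesq_self_eq_zero_of_hyperbolic_pair (H M : E →ₗ[ℂ] E →ₗ⋆[ℂ] ℂ)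
    (hH : ∀ x y, conj (H x y) = H y x) (hM : ∀ x y, conj (M x y) = M y x)
    (hHM : ∀ x, H x x = 0 → M x x = 0) {v w : E} (hv : H v v = 0) (hw : H w w = 0)
    (hvw : H v w = 1) (hMvw : M v w = 0) (x : E) : M x x = 0 := by
  have hwv : H w v = 1 := by rw [← hH, hvw, map_one]
  have hMwv : M w v = 0 := by rw [← hM, hMvw, map_zero]
  have hMv := hHM v hv
  have hMw := hHM w hw
  obtain ⟨u, a, b, rfl, huv, huw⟩ :
      ∃ (u : E) (a b : ℂ), x = u + a • v + b • w ∧ H u v = 0 ∧ H u w = 0 := by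
    refine ⟨x - H x w • v - H x v • w, H x w, H x v, by abel, ?_, ?_⟩ <;>
      simp [hv, hw, hvw, hwv]
  have hvu : H v u = 0 := by rw [← hH, huv, map_zero]
  have hwu : H w u = 0 := by rw [← hH, huw, map_zero]
  have expand (s t : ℂ) : M (u + s • v + t • w) (u + s • v + t • w) =
      M u u + conj s * M u v + s * M v u + conj t * M u w + t * M w u := by
    simp [hMv, hMw, hMvw, hMwv]
    ring
  have vanish (s t : ℂ) (hst : H u u + s * conj t + t * conj s = 0) :
      M u u + conj s * M u v + s * M v u + conj t * M u w + t * M w u = 0 := by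
    rw [← expand]
    apply hHM
    simp [hv, hw, hvw, hwv, huv, huw, hvu, hwu]
    linear_combination hst
  have hc : conj (H u u) = H u u := hH u u
  generalize H u u = c at hc vanish
  have I2 := Complex.I_mul_I
  have even : M u u = 0 := by
    have e₁ := vanish 1 (-c / 2) (by simp [hc, map_ofNat]; ring)
    have e₂ := vanish (-1) (c / 2) (by simp [hc, map_ofNat]; ring)
    simp only [map_neg, map_div₀, map_one, map_ofNat, hc] at e₁ e₂
    linear_combination (e₁ + e₂) / 2
  have relation (p q : ℝ) (hpq : c + 2 * p * q * c = 0) : p * M u v + q * c * M u w = 0 := by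
    have e₁ := vanish p (q * c) (by simp [hc]; linear_combination hpq)
    have e₂ := vanish (p * Complex.I) (q * c * Complex.I) (by
      simp [hc]; linear_combination hpq - 2 * p * q * c * I2)
    simp only [map_mul, Complex.conj_ofReal, Complex.conj_I, hc, even] at e₁ e₂
    linear_combination e₁ / 2 + Complex.I * e₂ / 2 + (p * M u v + q * c * M u w
      - p * M v u - q * c * M w u) / 2 * I2
  have relation' (p q : ℝ) (hpq : c + 2 * p * q * c = 0) : q * c * M u v + p * M u w = 0 := by
    have e₁ := vanish (q * c) p (by simp [hc]; linear_combination hpq)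
    have e₂ := vanish (q * c * Complex.I) (p * Complex.I) (by
      simp [hc]; linear_combination hpq - 2 * p * q * c * I2)
    simp only [map_mul, Complex.conj_ofReal, Complex.conj_I, hc, even] at e₁ e₂
    linear_combination e₁ / 2 + Complex.I * e₂ / 2 + (p * M u w + q * c * M u v
      - p * M w u - q * c * M v u) / 2 * I2
  have huv' : M u v = 0 := by
    have e₁ := relation 1 (-1 / 2) (by push_cast; ring)
    have e₂ := relation 2 (-1 / 4) (by push_cast; ring)
    push_cast at e₁ e₂
    linear_combination (2 * e₂ - e₁) / 3
  have huw' : M u w = 0 := by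
    have e₁ := relation' 1 (-1 / 2) (by push_cast; ring)
    push_cast at e₁
    linear_combination e₁ + c / 2 * huv'
  rw [expand, even, ← hM u v, ← hM u w, huv', huw']
  simp

/-- A hermitian form with a non-degenerate isotropic vector has a hyperbolic pair. -/
lemma exists_hyperbolic_pair (H : E →ₗ[ℂ] E →ₗ⋆[ℂ] ℂ) (hH : ∀ x y, conj (H x y) = H y x)
    {v : E} (hv : H v v = 0) (hv' : H v ≠ 0) : ∃ w, H w w = 0 ∧ H v w = 1 := by
  obtain ⟨y, hy⟩ : ∃ y, H v y ≠ 0 := by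
    by_contra! h
    exact hv' (LinearMap.ext h)
  obtain ⟨z, hz⟩ : ∃ z, H v z = 1 :=
    ⟨conj (H v y)⁻¹ • y, by simp [hy]⟩
  have hz' : H z v = 1 := by rw [← hH, hz, map_one]
  have hzz := hH z z
  refine ⟨z - (H z z / 2) • v, ?_, ?_⟩
  · simp [hv, hz, hz', hzz, map_ofNat]
    ring
  · simp [hv, hz]

/-- A hermitian form vanishing on all vectors is zero. -/
lemma sesq_eq_zero_of_self_eq_zero (M : E →ₗ[ℂ] E →ₗ⋆[ℂ] ℂ) (h : ∀ x, M x x = 0) (x y : E) :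
    M x y = 0 := by
  have e₁ := h (x + y)
  have e₂ := h (x + Complex.I • y)
  simp [h] at e₁ e₂
  linear_combination e₁ / 2 + Complex.I * e₂ / 2 + (M x y - M y x) / 2 * Complex.I_mul_I

/-- Two hermitian forms, the first having a non-degenerate isotropic vector, are proportional if
the second one vanishes on the isotropic vectors of the first one. -/
lemma exists_real_smul_of_isotropic_subset (H K : E →ₗ[ℂ] E →ₗ⋆[ℂ] ℂ)
    (hH : ∀ x y, conj (H x y) = H y x) (hK : ∀ x y, conj (K x y) = K y x)
    (hHK : ∀ x, H x x = 0 → K x x = 0) {v : E} (hv : H v v = 0) (hv' : H v ≠ 0) :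
    ∃ r : ℝ, ∀ x y, K x y = r * H x y := by
  obtain ⟨w, hw, hvw⟩ := exists_hyperbolic_pair H hH hv hv'
  have hwv : H w v = 1 := by rw [← hH, hvw, map_one]
  have hreal : conj (K v w) = K v w := by
    have e := hHK (v + Complex.I • w) (by simp [hv, hw, hvw, hwv])
    simp [hHK v hv, hHK w hw] at e
    rw [hK]
    linear_combination -Complex.I * e + (K w v - K v w) * Complex.I_mul_I
  obtain ⟨r, hr⟩ := Complex.conj_eq_iff_real.mp hreal
  refine ⟨r, fun x y => ?_⟩
  have key := sesq_eq_zero_of_self_eq_zero (K - (r : ℂ) • H)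
    (sesq_self_eq_zero_of_hyperbolic_pair H (K - (r : ℂ) • H) hH (by simp [hH, hK])
      (fun x hx => by simp [hx, hHK x hx]) hv hw hvw (by simp [hvw, hr])) x y
  simpa [sub_eq_zero] using key

end SesquilinearForms

/-- The sesquilinear form `(x, y) ↦ ⟨h x, y⟩`. -/
def hermForm (h : Module.End ℂ V3) : V3 →ₗ[ℂ] V3 →ₗ⋆[ℂ] ℂ :=
  LinearMap.mk₂'ₛₗ _ _ (fun x y => herm (h x) y)
    (fun _ _ _ => by simp [herm]; ring) (fun _ _ _ => by simp [herm]; ring)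
    (fun _ _ _ => by simp [herm]; ring) (fun _ _ _ => by simp [herm]; ring)

lemma hermForm_apply (h : Module.End ℂ V3) (x y : V3) : hermForm h x y = herm (h x) y := rfl

lemma herm_conj (x y : V3) : conj (herm x y) = herm y x := by
  simp [herm, mul_comm]

lemma herm_nondegenerate {x : V3} (hx : ∀ y, herm x y = 0) : x = 0 := by
  ext i
  have := hx (Pi.single i 1)
  fin_cases i <;> simpa [herm] using this

lemma SelfAdj.conj_hermForm {h : Module.End ℂ V3} (hh : SelfAdj h) (x y : V3) :
    conj (hermForm h x y) = hermForm h y x := by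
  rw [hermForm_apply, hermForm_apply, herm_conj, hh]

lemma projMk_mem_Bset_iff (h : Module.End ℂ V3) {v : V3} (hv : v ≠ 0) :
    projMk v hv ∈ Bset h ↔ herm (h v) v = 0 := by
  constructor
  · rintro ⟨w, hw, hvw, hw0⟩
    obtain ⟨a, rfl⟩ := (Projectivization.mk_eq_mk_iff' ℂ v w hv hw).mp hvw
    rw [← hermForm_apply] at hw0 ⊢
    simp [hw0]
  · exact fun h0 => ⟨v, hv, rfl, h0⟩

/-- `B_{h₁} = B_{h₂}` iff `h₂ = r·h₁` for some nonzero real `r`. -/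
theorem stmt_0 (h₁ h₂ : Module.End ℂ V3) (hb₁ : IsBisector h₁) (hb₂ : IsBisector h₂) :
    Bset h₁ = Bset h₂ ↔ ∃ r : ℝ, r ≠ 0 ∧ h₂ = r • h₁ := by
  have smul_apply (r : ℝ) (x y : V3) : herm ((r • h₁) x) y = r * herm (h₁ x) y := by
    simp [herm]
    ring
  constructor
  · intro hB
    obtain ⟨hs₁, -, -, v, hv, hv'⟩ := hb₁
    obtain ⟨hs₂, -, -, v₂, -, hv₂⟩ := hb₂
    obtain ⟨r, hr⟩ := exists_real_smul_of_isotropic_subset (hermForm h₁) (hermForm h₂)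
      hs₁.conj_hermForm hs₂.conj_hermForm
      (fun x hx => by
        rcases eq_or_ne x 0 with rfl | hx0
        · simp
        · rw [hermForm_apply] at hx ⊢
          rwa [← projMk_mem_Bset_iff h₂ hx0, ← hB, projMk_mem_Bset_iff])
      hv (fun h0 => hv' (herm_nondegenerate fun y => LinearMap.congr_fun h0 y))
    have heq : h₂ = r • h₁ := by
      refine LinearMap.ext fun x => sub_eq_zero.mp (herm_nondegenerate fun y => ?_)
      have e := hr x y
      rw [hermForm_apply, hermForm_apply, ← smul_apply] at e
      have hsub : herm (h₂ x - (r • h₁) x) y = herm (h₂ x) y - herm ((r • h₁) x) y := by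
        simp only [herm, Pi.sub_apply]
        ring
      rw [hsub, e, sub_self]
    refine ⟨r, ?_, heq⟩
    rintro rfl
    exact hv₂ (by simp [heq])
  · rintro ⟨r, hr, rfl⟩
    simp only [Bset, smul_apply, mul_eq_zero, Complex.ofReal_eq_zero, hr, false_or]

end
end

section
/- Let W be a linear family of bisectors. Assume it is NOT the case that dim_ℝ W ≥ 3 and there exists a nonzero f₀ ∈ V with ⟨f₀,f₀⟩ < 0 and h f₀ = 0 for all h ∈ W (i.e., W is not a confocal 3- or 4-dimensional family with negative common focus). Then W is completely determined by its base: W = {h : V → V ℂ-linear | tr h = 0, h* = h, and ⟨h v, v⟩ = 0 for every [v] ∈ B_W}. -/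
open scoped ComplexConjugate

noncomputable section

open Matrix

/-- `3 × 3` complex matrices, regarded as sesquilinear forms on `ℂ³`. -/
abbrev M3 : Type := Matrix (Fin 3) (Fin 3) ℂ

/-- The value `v* A v`. -/
def qf (A : M3) (v : Fin 3 → ℂ) : ℂ := star v ⬝ᵥ (A *ᵥ v)

/-- A family of matrices containing every Hermitian form that vanishes on its base. -/
def Determined (W : Submodule ℝ M3) : Prop :=
  ∀ g : M3, g.IsHermitian → (∀ v, (∀ A ∈ W, qf A v = 0) → qf g v = 0) → g ∈ W

/-- A family of dimension at least `3` with a common kernel vector that spans its base. -/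
def Confocal (W : Submodule ℝ M3) : Prop :=
  3 ≤ Module.finrank ℝ W ∧ ∃ f : Fin 3 → ℂ, (∀ A ∈ W, A *ᵥ f = 0) ∧
    ∀ v, (∀ A ∈ W, qf A v = 0) → ∃ c : ℂ, v = c • f

/-- The change of variables `A ↦ C* A C`. -/
def congrMap (C : M3) : M3 →ₗ[ℝ] M3 where
  toFun A := Cᴴ * A * C
  map_add' A B := by rw [mul_add, add_mul]
  map_smul' r A := by simp

lemma congrMap_apply (C A : M3) : congrMap C A = Cᴴ * A * C := rfl

lemma qf_congrMap (C A : M3) (v : Fin 3 → ℂ) : qf (congrMap C A) v = qf A (C *ᵥ v) := by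
  simp only [qf, congrMap_apply, ← mulVec_mulVec, star_mulVec, dotProduct_mulVec, vecMul_vecMul]

lemma congrMap_injective {C D : M3} (h : C * D = 1) : Function.Injective (congrMap C) := by
  have h' : Dᴴ * Cᴴ = 1 := by rw [← conjTranspose_mul, h, conjTranspose_one]
  intro A B hAB
  have := congrArg (fun X => Dᴴ * X * D) hAB
  simpa [congrMap_apply, mul_assoc, h, ← mul_assoc Dᴴ, h'] using this

lemma Determined.of_map {C D : M3} (h : C * D = 1) {W : Submodule ℝ M3}
    (hW : Determined (W.map (congrMap C))) : Determined W := by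
  intro g hg hv
  have key := hW (congrMap C g) (isHermitian_conjTranspose_mul_mul C hg) fun v hA => by
    rw [qf_congrMap]
    exact hv _ fun A hAW => by
      rw [← qf_congrMap]; exact hA _ (Submodule.mem_map_of_mem hAW)
  obtain ⟨A, hA, hAg⟩ := key
  rwa [← congrMap_injective h hAg]

lemma Confocal.of_map {C D : M3} (h : C * D = 1) {W : Submodule ℝ M3}
    (hW : Confocal (W.map (congrMap C))) : Confocal W := by
  obtain ⟨h3, f, hk, hf⟩ := hW
  have h' : Dᴴ * Cᴴ = 1 := by rw [← conjTranspose_mul, h, conjTranspose_one]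
  refine ⟨?_, C *ᵥ f, ?_, ?_⟩
  · rwa [← (Submodule.equivMapOfInjective _ (congrMap_injective h) W).finrank_eq] at h3
  · intro A hA
    have := congrArg (Dᴴ *ᵥ ·) (hk _ (Submodule.mem_map_of_mem hA))
    simpa [congrMap_apply, h', ← mul_assoc] using this
  · intro v hv
    have hCDv : C *ᵥ (D *ᵥ v) = v := by rw [mulVec_mulVec, h, one_mulVec]
    obtain ⟨c, hc⟩ := hf (D *ᵥ v) (by
      rintro _ ⟨A, hA, rfl⟩
      rw [qf_congrMap, hCDv, hv A hA])
    exact ⟨c, by rw [← hCDv, hc, mulVec_smul]⟩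

/-- A family of singular traceless Hermitian matrices. -/
def TracelessSingular (W : Submodule ℝ M3) : Prop :=
  ∀ A ∈ W, A.IsHermitian ∧ A.trace = 0 ∧ A.det = 0

lemma TracelessSingular.map {C : M3} (h : C * Cᴴ = 1) {W : Submodule ℝ M3}
    (hW : TracelessSingular W) : TracelessSingular (W.map (congrMap C)) := by
  rintro _ ⟨A, hA, rfl⟩
  obtain ⟨h1, h2, h3⟩ := hW A hA
  refine ⟨isHermitian_conjTranspose_mul_mul C h1, ?_, ?_⟩
  · rw [congrMap_apply, trace_mul_comm, ← mul_assoc, h, one_mul, h2]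
  · rw [congrMap_apply, det_mul, det_mul, h3]; simp

def swapMat : M3 := !![0, 1, 0; 1, 0, 0; 0, 0, 0]

lemma exists_congr_diagonal (e : Fin 3 → ℝ) (hs : e 0 + e 1 + e 2 = 0) (hp : e 0 * e 1 * e 2 = 0) :
    ∃ (P : M3) (r : ℝ), Pᴴ * P = 1 ∧ congrMap P (diagonal fun i => (e i : ℂ)) = r • swapMat := by
  obtain ⟨s, hs2⟩ : ∃ s : ℝ, (s : ℂ) * s = 1 / 2 := by
    refine ⟨√(1 / 2), ?_⟩
    rw [← Complex.ofReal_mul, Real.mul_self_sqrt (by norm_num)]; norm_num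
  rcases mul_eq_zero.mp hp with hp | h2
  · rcases mul_eq_zero.mp hp with h0 | h1
    · refine ⟨!![0, 0, 1; s, s, 0; s, -s, 0], e 1, ?_, ?_⟩
      · ext i j; fin_cases i <;> fin_cases j <;>
          simp [mul_apply, Fin.sum_univ_three, hs2, conjTranspose_apply] <;> norm_num
      · have h' : (e 2 : ℂ) = - e 1 := by
          rw [← Complex.ofReal_neg]; congr 1; linarith
        ext i j; fin_cases i <;> fin_cases j <;>
          simp [congrMap_apply, mul_apply, Fin.sum_univ_three, swapMat, diagonal_apply, h', h0] <;>
          linear_combination 2 * (e 1 : ℂ) * hs2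
    · refine ⟨!![s, s, 0; 0, 0, 1; s, -s, 0], e 0, ?_, ?_⟩
      · ext i j; fin_cases i <;> fin_cases j <;>
          simp [mul_apply, Fin.sum_univ_three, hs2, conjTranspose_apply] <;> norm_num
      · have h' : (e 2 : ℂ) = - e 0 := by
          rw [← Complex.ofReal_neg]; congr 1; linarith
        ext i j; fin_cases i <;> fin_cases j <;>
          simp [congrMap_apply, mul_apply, Fin.sum_univ_three, swapMat, diagonal_apply, h', h1] <;>
          linear_combination 2 * (e 0 : ℂ) * hs2
  · refine ⟨!![s, s, 0; s, -s, 0; 0, 0, 1], e 0, ?_, ?_⟩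
    · ext i j; fin_cases i <;> fin_cases j <;>
        simp [mul_apply, Fin.sum_univ_three, hs2, conjTranspose_apply] <;> norm_num
    · have h' : (e 1 : ℂ) = - e 0 := by
        rw [← Complex.ofReal_neg]; congr 1; linarith
      ext i j; fin_cases i <;> fin_cases j <;>
        simp [congrMap_apply, mul_apply, Fin.sum_univ_three, swapMat, diagonal_apply, h', h2] <;>
        linear_combination 2 * (e 0 : ℂ) * hs2

/-- A nonzero singular traceless Hermitian matrix is a multiple of `swapMat` in a suitable
orthonormal basis. -/
lemma exists_unitary_congr {A : M3} (h1 : A.IsHermitian) (h2 : A.trace = 0) (h3 : A.det = 0)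
    (h0 : A ≠ 0) : ∃ (U : M3) (r : ℝ), U * Uᴴ = 1 ∧ r ≠ 0 ∧ congrMap U A = r • swapMat := by
  have ht : h1.eigenvalues 0 + h1.eigenvalues 1 + h1.eigenvalues 2 = 0 := by
    have := h1.trace_eq_sum_eigenvalues
    rw [h2, Fin.sum_univ_three] at this
    exact (Complex.ofReal_eq_zero.mp (by push_cast; exact this.symm))
  have hd : h1.eigenvalues 0 * h1.eigenvalues 1 * h1.eigenvalues 2 = 0 := by
    have := h1.det_eq_prod_eigenvalues
    rw [h3, Fin.prod_univ_three] at this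
    exact (Complex.ofReal_eq_zero.mp (by push_cast; exact this.symm))
  obtain ⟨P, r, hP, hPr⟩ := exists_congr_diagonal _ ht hd
  set V : M3 := (h1.eigenvectorUnitary : M3) with hV
  have hVV : V * Vᴴ = 1 := Unitary.mul_star_self_of_mem h1.eigenvectorUnitary.2
  have hUU : V * P * (V * P)ᴴ = 1 := by
    rw [conjTranspose_mul, mul_assoc, ← mul_assoc P, mul_eq_one_comm.mp hP, one_mul, hVV]
  have hA : congrMap (V * P) A = r • swapMat := by
    have := h1.conjStarAlgAut_star_eigenvectorUnitary
    rw [Unitary.conjStarAlgAut_star_apply] at this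
    rw [← hPr]
    simp only [congrMap_apply, conjTranspose_mul, mul_assoc]
    congr 1
    simp only [← mul_assoc]
    congr 1
  refine ⟨V * P, r, hUU, ?_, hA⟩
  rintro rfl
  apply h0
  apply congrMap_injective hUU
  rw [hA, zero_smul, map_zero]

lemma det_hermitian {A : M3} (h : A.IsHermitian) : A.det.re =
    (A 2 2).re * ((A 0 0).re * (A 1 1).re - (A 0 1).re ^ 2 - (A 0 1).im ^ 2)
    - (A 0 0).re * ((A 1 2).re ^ 2 + (A 1 2).im ^ 2)
    - (A 1 1).re * ((A 0 2).re ^ 2 + (A 0 2).im ^ 2)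
    + 2 * ((A 0 1).re * ((A 1 2).re * (A 0 2).re + (A 1 2).im * (A 0 2).im)
      - (A 0 1).im * ((A 1 2).im * (A 0 2).re - (A 1 2).re * (A 0 2).im)) := by
  have hd : ∀ i, (A i i).im = 0 := fun i => Complex.conj_eq_iff_im.mp (h.apply i i)
  rw [det_fin_three, ← h.apply 1 0, ← h.apply 2 0, ← h.apply 2 1]
  simp [hd]
  ring

lemma qf_hermitian {A : M3} (h : A.IsHermitian) (v : Fin 3 → ℂ) : qf A v =
    (((A 0 0).re * ((v 0).re ^ 2 + (v 0).im ^ 2) + (A 1 1).re * ((v 1).re ^ 2 + (v 1).im ^ 2)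
      + (A 2 2).re * ((v 2).re ^ 2 + (v 2).im ^ 2)
      + 2 * ((A 0 1).re * ((v 0).re * (v 1).re + (v 0).im * (v 1).im)
        - (A 0 1).im * ((v 0).re * (v 1).im - (v 0).im * (v 1).re))
      + 2 * ((A 0 2).re * ((v 0).re * (v 2).re + (v 0).im * (v 2).im)
        - (A 0 2).im * ((v 0).re * (v 2).im - (v 0).im * (v 2).re))
      + 2 * ((A 1 2).re * ((v 1).re * (v 2).re + (v 1).im * (v 2).im)
        - (A 1 2).im * ((v 1).re * (v 2).im - (v 1).im * (v 2).re)) : ℝ) : ℂ) := by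
  have hd : ∀ i, (A i i).im = 0 := fun i => Complex.conj_eq_iff_im.mp (h.apply i i)
  rw [qf, dotProduct, Fin.sum_univ_three]
  simp only [mulVec, dotProduct, Fin.sum_univ_three]
  rw [← h.apply 1 0, ← h.apply 2 0, ← h.apply 2 1]
  apply Complex.ext
  · rw [Complex.ofReal_re]
    simp [hd]
    ring
  · rw [Complex.ofReal_im]
    simp [hd]
    ring

lemma Matrix.IsHermitian.ext_upper {A B : M3} (hA : A.IsHermitian) (hB : B.IsHermitian)
    (h0 : (A 0 0).re = (B 0 0).re) (h1 : (A 1 1).re = (B 1 1).re) (h2 : (A 2 2).re = (B 2 2).re)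
    (h01 : A 0 1 = B 0 1) (h02 : A 0 2 = B 0 2) (h12 : A 1 2 = B 1 2) : A = B := by
  have hd : ∀ {C : M3}, C.IsHermitian → ∀ i, (C i i).im = 0 := fun h i =>
    Complex.conj_eq_iff_im.mp (h.apply i i)
  ext i j
  fin_cases i <;> fin_cases j
  · exact Complex.ext h0 (by simp [hd hA, hd hB])
  · exact h01
  · exact h02
  · simpa [hA.apply 1 0, hB.apply 1 0] using congrArg star h01
  · exact Complex.ext h1 (by simp [hd hA, hd hB])
  · exact h12
  · simpa [hA.apply 2 0, hB.apply 2 0] using congrArg star h02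
  · simpa [hA.apply 2 1, hB.apply 2 1] using congrArg star h12
  · exact Complex.ext h2 (by simp [hd hA, hd hB])

lemma swapMat_isHermitian : swapMat.IsHermitian := by
  ext i j; fin_cases i <;> fin_cases j <;> simp [swapMat]

/-- The equations obtained from `det (k + t • swapMat) = 0` and `tr k = 0`. -/
lemma TracelessSingular.relations {W : Submodule ℝ M3} (hW : TracelessSingular W)
    (hs : swapMat ∈ W) {k : M3} (hk : k ∈ W) :
    (k 2 2).re = 0 ∧ (k 1 1).re = -(k 0 0).re ∧
      (k 0 2).re * (k 1 2).re + (k 0 2).im * (k 1 2).im = 0 ∧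
      (k 0 0).re * ((k 0 2).re ^ 2 + (k 0 2).im ^ 2 - (k 1 2).re ^ 2 - (k 1 2).im ^ 2)
        - 2 * (k 0 1).im * ((k 1 2).im * (k 0 2).re - (k 1 2).re * (k 0 2).im) = 0 := by
  have hd : ∀ t : ℝ, (k + t • swapMat).det.re = 0 := fun t => by
    rw [(hW _ (W.add_mem hk (W.smul_mem t hs))).2.2]; rfl
  have hh : ∀ t : ℝ, (k + t • swapMat).IsHermitian := fun t =>
    (hW _ (W.add_mem hk (W.smul_mem t hs))).1
  have ht := congrArg Complex.re (hW k hk).2.1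
  rw [trace_fin_three] at ht
  have e0 := hd 0
  have e1 := hd 1
  have e2 := hd (-1)
  rw [det_hermitian (hh _)] at e0 e1 e2
  simp [swapMat] at e0 e1 e2 ht
  have h22 : (k 2 2).re = 0 := by linarith
  have h12 : (k 0 2).re * (k 1 2).re + (k 0 2).im * (k 1 2).im = 0 := by
    linear_combination (e1 - e2) / 4 + (k 0 1).re * h22
  have h11 : (k 1 1).re = -(k 0 0).re := by linarith
  refine ⟨h22, h11, h12, ?_⟩
  rw [h22, h11] at e0
  linear_combination e0 - 2 * (k 0 1).re * h12

lemma determined_of_common_line {W : Submodule ℝ M3} (hW : ∀ A ∈ W, A.IsHermitian)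
    (hE : ∀ A ∈ W, (A 0 0).re = 0 ∧ (A 1 1).re = 0 ∧ (A 2 2).re = 0 ∧ A 1 2 = 0) :
    Determined W := by
  intro g hg hv
  have key : ∀ s t : ℂ, (∀ A ∈ W, (A 0 1 * s + A 0 2 * t).re = 0) →
      (g 0 0).re + (g 1 1).re * (s.re ^ 2 + s.im ^ 2) + (g 2 2).re * (t.re ^ 2 + t.im ^ 2)
        + 2 * (g 0 1 * s + g 0 2 * t).re + 2 * ((g 1 2).re * (s.re * t.re + s.im * t.im)
        - (g 1 2).im * (s.re * t.im - s.im * t.re)) = 0 := by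
    intro s t hA
    have := hv ![1, s, t] fun A hAW => by
      obtain ⟨h0, h1, h2, h3⟩ := hE A hAW
      have := hA A hAW
      simp at this
      rw [qf_hermitian (hW A hAW), Complex.ofReal_eq_zero]
      simp [h0, h1, h2, h3]
      linear_combination 2 * this
    rw [qf_hermitian hg, Complex.ofReal_eq_zero] at this
    simp at this ⊢
    linear_combination this
  have line : ∀ s t : ℂ, (g 1 1).re * (s.re ^ 2 + s.im ^ 2) + (g 2 2).re * (t.re ^ 2 + t.im ^ 2)
        + 2 * ((g 1 2).re * (s.re * t.re + s.im * t.im)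
        - (g 1 2).im * (s.re * t.im - s.im * t.re)) = 0 := by
    intro s t
    have := hv ![0, s, t] fun A hAW => by
      obtain ⟨h0, h1, h2, h3⟩ := hE A hAW
      rw [qf_hermitian (hW A hAW), Complex.ofReal_eq_zero]
      simp [h1, h2, h3]
    rw [qf_hermitian hg, Complex.ofReal_eq_zero] at this
    simpa using this
  have h11 : (g 1 1).re = 0 := by simpa using line 1 0
  have h22 : (g 2 2).re = 0 := by simpa using line 0 1
  have h12 : g 1 2 = 0 := by
    apply Complex.ext
    · simpa [h11, h22] using line 1 1
    · simpa [h11, h22] using line 1 Complex.I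
  have h00 : (g 0 0).re = 0 := by simpa using key 0 0 (by simp)
  by_contra hgW
  obtain ⟨ψ, hψg, hψ⟩ := W.exists_le_ker_of_notMem hgW
  set X : ℂ → ℂ → M3 := fun b x => !![0, b, x; star b, 0, 0; star x, 0, 0] with hX
  have hXh : ∀ b x, (X b x).IsHermitian := fun b x => by
    ext i j; fin_cases i <;> fin_cases j <;> simp [hX]
  set s : ℂ := ⟨ψ (X 1 0), -ψ (X Complex.I 0)⟩ with hs
  set t : ℂ := ⟨ψ (X 0 1), -ψ (X 0 Complex.I)⟩ with ht
  have hψX : ∀ A : M3, A.IsHermitian → (A 0 0).re = 0 → (A 1 1).re = 0 → (A 2 2).re = 0 →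
      A 1 2 = 0 → ψ A = (A 0 1 * s + A 0 2 * t).re := by
    intro A hA h0 h1 h2 h3
    have : A = (A 0 1).re • X 1 0 + (A 0 1).im • X Complex.I 0 + (A 0 2).re • X 0 1
        + (A 0 2).im • X 0 Complex.I := by
      refine hA.ext_upper ?_ (by simp [hX, h0]) (by simp [hX, h1]) (by simp [hX, h2]) ?_ ?_ ?_
      · have hsm : ∀ (r : ℝ) b x, (r • X b x).IsHermitian := fun r b x =>
          (hXh b x).smul (IsSelfAdjoint.all r)
        exact (((hsm _ _ _).add (hsm _ _ _)).add (hsm _ _ _)).add (hsm _ _ _)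
      · apply Complex.ext <;> simp [hX]
      · apply Complex.ext <;> simp [hX]
      · simp [hX, h3]
    rw [this]
    simp only [map_add, map_smul]
    simp [hs, ht, hX]
    ring
  have h := key s t fun A hA => by
    obtain ⟨h0, h1, h2, h3⟩ := hE A hA
    rw [← hψX A (hW A hA) h0 h1 h2 h3]
    exact hψ hA
  rw [← hψX g hg h00 h11 h22 h12, h00, h11, h22, h12] at h
  apply hψg
  simpa using h

lemma determined_of_realPlane {W : Submodule ℝ M3} (hW : ∀ A ∈ W, A.IsHermitian)
    (hE : ∀ A ∈ W, (A 0 0).re = 0 ∧ (A 1 1).re = 0 ∧ (A 2 2).re = 0 ∧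
      (A 0 1).im = 0 ∧ (A 0 2).im = 0 ∧ (A 1 2).re = 0) (hs : swapMat ∈ W)
    {k l : M3} (hk : k ∈ W) (hl : l ∈ W) (hk2 : k 0 2 = 1) (hk12 : k 1 2 = 0)
    (hl12 : l 1 2 = Complex.I) :
    Determined W := by
  intro g hg hv
  have key : ∀ a b c : ℝ, (g 0 0).re * a ^ 2 + (g 1 1).re * b ^ 2 + (g 2 2).re * c ^ 2
      + 2 * ((g 0 1).im * (a * b) + (g 0 2).im * (a * c) + (g 1 2).re * (b * c)) = 0 := by
    intro a b c
    have := hv ![⟨0, a⟩, b, c] fun A hAW => by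
      obtain ⟨h0, h1, h2, h3, h4, h5⟩ := hE A hAW
      rw [qf_hermitian (hW A hAW), Complex.ofReal_eq_zero]
      simp [h0, h1, h2, h3, h4, h5]
    rw [qf_hermitian hg, Complex.ofReal_eq_zero] at this
    simp at this
    linear_combination this
  have h00 : (g 0 0).re = 0 := by simpa using key 1 0 0
  have h11 : (g 1 1).re = 0 := by simpa using key 0 1 0
  have h22 : (g 2 2).re = 0 := by simpa using key 0 0 1
  have h01 : (g 0 1).im = 0 := by simpa [h00, h11] using key 1 1 0
  have h02 : (g 0 2).im = 0 := by simpa [h00, h22] using key 1 0 1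
  have h12 : (g 1 2).re = 0 := by simpa [h11, h22] using key 0 1 1
  set β := (g 1 2).im
  set γ := (g 0 2).re - β * (l 0 2).re
  have hmem : ((g 0 1).re - γ * (k 0 1).re - β * (l 0 1).re) • swapMat + γ • k + β • l ∈ W :=
    W.add_mem (W.add_mem (W.smul_mem _ hs) (W.smul_mem _ hk)) (W.smul_mem _ hl)
  obtain ⟨h0, h1, h2, h3, h4, h5⟩ := hE _ hmem
  convert hmem
  refine hg.ext_upper (hW _ hmem) (h00.trans h0.symm) (h11.trans h1.symm) (h22.trans h2.symm)
    (Complex.ext ?_ (h01.trans h3.symm)) (Complex.ext ?_ (h02.trans h4.symm))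
    (Complex.ext (h12.trans h5.symm) ?_)
  · simp [swapMat]
    ring
  · simp [swapMat, hk2, γ]
  · simp [swapMat, hk12, hl12, β]

lemma determined_of_aligned {W : Submodule ℝ M3} (hW : TracelessSingular W)
    (hs : swapMat ∈ W) {l : M3} (hl : l ∈ W) (hl2 : l 0 2 = 1) (hl12 : l 1 2 = 0) :
    Determined W := by
  have hl0 : (l 0 0).re = 0 := by simpa [hl2, hl12] using (hW.relations hs hl).2.2.2
  set m := (l 0 1).im with hm
  have rel : ∀ k ∈ W, (k 1 2).re = 0 ∧ (k 0 2).im * (k 1 2).im = 0 ∧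
      (k 0 0).re = 2 * m * (k 1 2).im ∧
      (k 1 2).im * (m * (k 0 2).re - (k 0 1).im) = 0 ∧ m * (k 1 2).im = 0 := by
    intro k hk
    obtain ⟨-, -, h3, h4⟩ := hW.relations hs hk
    obtain ⟨-, -, p3, p4⟩ := hW.relations hs (W.add_mem hk hl)
    obtain ⟨-, -, -, q4⟩ := hW.relations hs (W.sub_mem hk hl)
    simp [hl2, hl12, hl0, ← hm] at p3 p4 q4
    have hy : (k 1 2).re = 0 := by linear_combination p3 - h3
    rw [hy] at h3 h4 p4 q4
    have hx : (k 0 2).im * (k 1 2).im = 0 := by linear_combination h3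
    have ha : (k 0 0).re = 2 * m * (k 1 2).im := by linear_combination (p4 + q4) / 2 - h4
    have h5 : (k 1 2).im * (m * (k 0 2).re - (k 0 1).im) = 0 := by
      linear_combination (p4 - q4) / 4 - (k 0 2).re * ha
    refine ⟨hy, hx, ha, h5, ?_⟩
    have h6 : m * (k 1 2).im * (k 1 2).im ^ 2 = 0 := by
      rw [ha] at h4
      linear_combination (k 0 2).re * h5 + m * (k 0 2).im * hx - h4 / 2
    rcases mul_eq_zero.mp h6 with h | h
    · exact h
    · rw [pow_eq_zero_iff two_ne_zero] at h
      rw [h, mul_zero]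
  have hd : ∀ k ∈ W, (k 1 1).re = -(k 0 0).re ∧ (k 2 2).re = 0 := fun k hk =>
    ⟨(hW.relations hs hk).2.1, (hW.relations hs hk).1⟩
  by_cases hη : ∀ k ∈ W, (k 1 2).im = 0
  · refine determined_of_common_line (fun A hA => (hW A hA).1) fun A hA => ?_
    obtain ⟨r1, -, r3, -, -⟩ := rel A hA
    rw [hη A hA, mul_zero] at r3
    exact ⟨r3, by rw [(hd A hA).1, r3, neg_zero], (hd A hA).2, Complex.ext r1 (hη A hA)⟩
  · push Not at hη
    obtain ⟨k, hk, hkη⟩ := hη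
    have hm0 : m = 0 := (mul_eq_zero.mp (rel k hk).2.2.2.2).resolve_right hkη
    have real_of_ne : ∀ A ∈ W, (A 1 2).im ≠ 0 → (A 0 1).im = 0 ∧ (A 0 2).im = 0 := by
      intro A hA hne
      obtain ⟨-, r2, -, r4, -⟩ := rel A hA
      refine ⟨?_, (mul_eq_zero.mp r2).resolve_right hne⟩
      simpa [hm0, hne] using r4
    have real : ∀ A ∈ W, (A 0 1).im = 0 ∧ (A 0 2).im = 0 := by
      intro A hA
      by_cases hne : (A 1 2).im = 0
      · have := real_of_ne _ (W.add_mem hA hk) (by simpa [hne] using hkη)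
        simpa [real_of_ne k hk hkη] using this
      · exact real_of_ne A hA hne
    refine determined_of_realPlane (fun A hA => (hW A hA).1) (fun A hA => ?_) hs hl
      (W.smul_mem (k 1 2).im⁻¹ hk) hl2 hl12 ?_
    · obtain ⟨r1, -, r3, -, -⟩ := rel A hA
      have r0 : (A 0 0).re = 0 := by rw [r3, hm0]; ring
      exact ⟨r0, by rw [(hd A hA).1, r0, neg_zero], (hd A hA).2, (real A hA).1, (real A hA).2, r1⟩
    · apply Complex.ext
      · simp [(rel k hk).1]
      · simp [hkη]

def skewMat : M3 := !![0, Complex.I, 0; -Complex.I, 0, 0; 0, 0, 0]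

def diagMat : M3 := !![1, 0, 0; 0, -1, 0; 0, 0, 0]

lemma skewMat_isHermitian : skewMat.IsHermitian := by
  ext i j; fin_cases i <;> fin_cases j <;> simp [skewMat]

lemma diagMat_isHermitian : diagMat.IsHermitian := by
  ext i j; fin_cases i <;> fin_cases j <;> simp [diagMat]

/-- The real span of `swapMat`, `diagMat` and `skewMat`. -/
def IsPlanar (A : M3) : Prop :=
  A.IsHermitian ∧ (A 1 1).re = -(A 0 0).re ∧ (A 2 2).re = 0 ∧ A 0 2 = 0 ∧ A 1 2 = 0

lemma IsPlanar.eq {A : M3} (h : IsPlanar A) :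
    A = (A 0 1).re • swapMat + (A 0 0).re • diagMat + (A 0 1).im • skewMat := by
  obtain ⟨h0, h1, h2, h3, h4⟩ := h
  refine h0.ext_upper ?_ ?_ ?_ ?_ ?_ ?_ ?_
  · exact ((swapMat_isHermitian.smul (IsSelfAdjoint.all _)).add
      (diagMat_isHermitian.smul (IsSelfAdjoint.all _))).add
      (skewMat_isHermitian.smul (IsSelfAdjoint.all _))
  · simp [swapMat, diagMat, skewMat]
  · simp [swapMat, diagMat, skewMat, h1]
  · simp [swapMat, diagMat, skewMat, h2]
  · apply Complex.ext <;> simp [swapMat, diagMat, skewMat]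
  · simp [swapMat, diagMat, skewMat, h3]
  · simp [swapMat, diagMat, skewMat, h4]

/-- A planar matrix outside `W` is separated from `W` by a functional `ψ` vanishing on `swapMat`;
such a functional has the form below, by taking a complex square root. -/
lemma exists_separating {W : Submodule ℝ M3} (hs : swapMat ∈ W) (hW : ∀ A ∈ W, IsPlanar A)
    {B : M3} (hB : IsPlanar B) (hBW : B ∉ W) : ∃ p r : ℝ,
      (∀ A ∈ W, (p ^ 2 - r ^ 2) * (A 0 0).re - 2 * p * r * (A 0 1).im = 0) ∧
      (p ^ 2 - r ^ 2) * (B 0 0).re - 2 * p * r * (B 0 1).im ≠ 0 := by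
  obtain ⟨ψ, hψB, hψ⟩ := W.exists_le_ker_of_notMem hBW
  obtain ⟨w, hw⟩ := IsAlgClosed.exists_eq_mul_self (⟨ψ diagMat, -ψ skewMat⟩ : ℂ)
  have h1 : ψ diagMat = w.re ^ 2 - w.im ^ 2 := by
    have := congrArg Complex.re hw
    simp at this
    linear_combination this
  have h2 : ψ skewMat = -(2 * w.re * w.im) := by
    have := congrArg Complex.im hw
    simp at this
    linear_combination -this
  have hψ0 : ψ swapMat = 0 := hψ hs
  have hval : ∀ A, IsPlanar A → ψ A =
      (w.re ^ 2 - w.im ^ 2) * (A 0 0).re - 2 * w.re * w.im * (A 0 1).im := by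
    intro A hA
    conv_lhs => rw [hA.eq]
    simp only [map_add, map_smul, hψ0, h1, h2, smul_eq_mul]
    ring
  exact ⟨w.re, w.im, fun A hA => by rw [← hval A (hW A hA)]; exact hψ hA,
    by rwa [← hval B hB]⟩

lemma isPlanar_of_vanishing {W : Submodule ℝ M3} (hW : ∀ A ∈ W, IsPlanar A) {p r : ℝ}
    (hpr : p ^ 2 + r ^ 2 ≠ 0)
    (hN : ∀ A ∈ W, (p ^ 2 - r ^ 2) * (A 0 0).re - 2 * p * r * (A 0 1).im = 0)
    {g : M3} (hg : g.IsHermitian) (hv : ∀ v, (∀ A ∈ W, qf A v = 0) → qf g v = 0) :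
    IsPlanar g ∧ (p ^ 2 - r ^ 2) * (g 0 0).re - 2 * p * r * (g 0 1).im = 0 := by
  have key1 : ∀ t : ℂ, p ^ 2 * (g 0 0).re + r ^ 2 * (g 1 1).re - 2 * p * r * (g 0 1).im
      + (g 2 2).re * (t.re ^ 2 + t.im ^ 2) + 2 * p * ((g 0 2).re * t.re - (g 0 2).im * t.im)
      + 2 * r * ((g 1 2).re * t.im + (g 1 2).im * t.re) = 0 := by
    intro t
    have := hv ![p, ⟨0, r⟩, t] fun A hA => by
      obtain ⟨h0, h1, h2, h3, h4⟩ := hW A hA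
      rw [qf_hermitian h0, Complex.ofReal_eq_zero]
      simp [h1, h2, h3, h4]
      linear_combination hN A hA
    rw [qf_hermitian hg, Complex.ofReal_eq_zero] at this
    simp at this
    linear_combination this
  have key2 : ∀ t : ℂ, r ^ 2 * (g 0 0).re + p ^ 2 * (g 1 1).re + 2 * p * r * (g 0 1).im
      + (g 2 2).re * (t.re ^ 2 + t.im ^ 2) + 2 * r * ((g 0 2).re * t.re - (g 0 2).im * t.im)
      - 2 * p * ((g 1 2).re * t.im + (g 1 2).im * t.re) = 0 := by
    intro t
    have := hv ![r, ⟨0, -p⟩, t] fun A hA => by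
      obtain ⟨h0, h1, h2, h3, h4⟩ := hW A hA
      rw [qf_hermitian h0, Complex.ofReal_eq_zero]
      simp [h1, h2, h3, h4]
      linear_combination -hN A hA
    rw [qf_hermitian hg, Complex.ofReal_eq_zero] at this
    simp at this
    linear_combination this
  have a0 := key1 0
  have a1 := key1 1
  have a2 := key1 (-1)
  have a3 := key1 Complex.I
  have b0 := key2 0
  have b1 := key2 1
  have b3 := key2 Complex.I
  simp at a0 a1 a2 a3 b0 b1 b3
  have h22 : (g 2 2).re = 0 := by linear_combination (a1 + a2) / 2 - a0
  rw [h22] at a1 a3 b1 b3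
  have cancel : ∀ {x : ℝ}, (p ^ 2 + r ^ 2) * x = 0 → x = 0 := fun h =>
    (mul_eq_zero.mp h).resolve_left hpr
  have h11 : (g 1 1).re = -(g 0 0).re := by
    rw [eq_neg_iff_add_eq_zero]
    exact cancel (by linear_combination a0 + b0)
  refine ⟨⟨hg, h11, h22, Complex.ext (cancel ?_) (cancel ?_), Complex.ext (cancel ?_) (cancel ?_)⟩,
    ?_⟩
  · linear_combination p / 2 * (a1 - a0) + r / 2 * (b1 - b0)
  · linear_combination - (p / 2) * (a3 - a0) - r / 2 * (b3 - b0)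
  · linear_combination r / 2 * (a3 - a0) - p / 2 * (b3 - b0)
  · linear_combination r / 2 * (a1 - a0) - p / 2 * (b1 - b0)
  · rw [h11] at a0
    linear_combination a0

lemma three_le_finrank {W : Submodule ℝ M3} (hs : swapMat ∈ W) (hd : diagMat ∈ W)
    (hk : skewMat ∈ W) : 3 ≤ Module.finrank ℝ W := by
  have hli : LinearIndependent ℝ ![(⟨swapMat, hs⟩ : W), ⟨diagMat, hd⟩, ⟨skewMat, hk⟩] := by
    rw [Fintype.linearIndependent_iff]
    intro c hc
    have hc' := congrArg (Subtype.val : W → M3) hc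
    simp [Fin.sum_univ_three] at hc'
    have h00 := congrFun (congrFun hc' 0) 0
    have h01 := congrFun (congrFun hc' 0) 1
    have hre := congrArg Complex.re h01
    have him := congrArg Complex.im h01
    simp [swapMat, diagMat, skewMat] at h00 hre him
    intro i
    fin_cases i <;> assumption
  simpa using hli.fintype_card_le_finrank

lemma confocal_of_planar {W : Submodule ℝ M3} (hW : ∀ A, A ∈ W ↔ IsPlanar A) : Confocal W := by
  have hs : swapMat ∈ W := (hW _).mpr ⟨swapMat_isHermitian, by simp [swapMat]⟩
  have hd : diagMat ∈ W := (hW _).mpr ⟨diagMat_isHermitian, by simp [diagMat]⟩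
  have hk : skewMat ∈ W := (hW _).mpr ⟨skewMat_isHermitian, by simp [skewMat]⟩
  refine ⟨three_le_finrank hs hd hk, ![0, 0, 1], fun A hA => ?_, fun v hv => ⟨v 2, ?_⟩⟩
  · obtain ⟨h0, -, h2, h3, h4⟩ := (hW A).mp hA
    ext i
    fin_cases i
    · simp [mulVec, dotProduct, Fin.sum_univ_three, h3]
    · simp [mulVec, dotProduct, Fin.sum_univ_three, h4]
    · simp [mulVec, dotProduct, Fin.sum_univ_three]
      exact Complex.ext h2 (Complex.conj_eq_iff_im.mp (h0.apply 2 2))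
  · have h1 := hv _ hs
    have h2 := hv _ hd
    have h3 := hv _ hk
    simp [qf, mulVec, dotProduct, Fin.sum_univ_three, swapMat, diagMat, skewMat] at h1 h2 h3
    have h4 : star (v 0) * v 1 = 0 := by
      rw [Complex.star_def]
      linear_combination h1 / 2 - Complex.I / 2 * h3
        + (starRingEnd ℂ) (v 0) * v 1 / 2 * Complex.I_mul_I
        - (starRingEnd ℂ) (v 1) * v 0 / 2 * Complex.I_mul_I
    have h5 : v 0 = 0 ∧ v 1 = 0 := by
      rcases mul_eq_zero.mp h4 with h | h
      · rw [star_eq_zero] at h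
        simpa [h] using h2
      · simpa [h] using h2
    ext i
    fin_cases i <;> simp [h5]

lemma determined_of_planar {W : Submodule ℝ M3} (hs : swapMat ∈ W) (hW : ∀ A ∈ W, IsPlanar A)
    (hex : ∃ B, IsPlanar B ∧ B ∉ W) : Determined W := by
  intro g hg hv
  obtain ⟨B, hB, hBW⟩ := hex
  have hpr : ∀ {p r x y : ℝ}, (p ^ 2 - r ^ 2) * x - 2 * p * r * y ≠ 0 → p ^ 2 + r ^ 2 ≠ 0 := by
    intro p r x y h h0
    have hp : p = 0 := by nlinarith
    have hr : r = 0 := by nlinarith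
    simp [hp, hr] at h
  obtain ⟨p, r, hN, hne⟩ := exists_separating hs hW hB hBW
  have hgp := (isPlanar_of_vanishing hW (hpr hne) hN hg hv).1
  by_contra hgW
  obtain ⟨p, r, hN, hne⟩ := exists_separating hs hW hgp hgW
  exact hne (isPlanar_of_vanishing hW (hpr hne) hN hg hv).2

lemma exists_rotation_parameters {x y : ℂ} (h : x.re * y.re + x.im * y.im = 0)
    (hne : x = 0 → y ≠ 0) : ∃ (p r : ℝ) (c : ℂ), p ^ 2 + r ^ 2 = 1 ∧ c ≠ 0 ∧
      x = c * p ∧ y = c * (Complex.I * r) := by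
  by_cases hx : x = 0
  · refine ⟨0, 1, -Complex.I * y, by norm_num, by simp [hne hx], by simp [hx], ?_⟩
    push_cast
    linear_combination y * Complex.I_mul_I
  · obtain ⟨τ, hτ⟩ : ∃ τ : ℝ, y = x * (Complex.I * τ) := by
      refine ⟨(y / x).im, ?_⟩
      have hre : (y / x).re = 0 := by
        rw [Complex.div_re, ← add_div]
        rw [show y.re * x.re + y.im * x.im = 0 by linear_combination h, zero_div]
      have : y / x = Complex.I * (y / x).im := by apply Complex.ext <;> simp [hre]
      rw [← this, mul_div_cancel₀ _ hx]
    have hn : 0 < 1 + τ ^ 2 := by positivity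
    have hs : √(1 + τ ^ 2) ≠ 0 := (Real.sqrt_pos.mpr hn).ne'
    have hs' : (√(1 + τ ^ 2) : ℂ) ≠ 0 := by exact_mod_cast hs
    refine ⟨1 / √(1 + τ ^ 2), τ / √(1 + τ ^ 2), √(1 + τ ^ 2) * x, ?_, mul_ne_zero hs' hx, ?_, ?_⟩
    · rw [div_pow, div_pow, Real.sq_sqrt hn.le, one_pow, ← add_div, div_self hn.ne']
    · push_cast; field_simp
    · rw [hτ]; push_cast; field_simp

/-- A unitary change of variables that fixes `swapMat` and makes the last column of `k`
proportional to the first basis vector. -/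
lemma exists_aligning_unitary {k : M3} {p r : ℝ} {c : ℂ} (hpr : p ^ 2 + r ^ 2 = 1) (hc : c ≠ 0)
    (hx : k 0 2 = c * p) (hy : k 1 2 = c * (Complex.I * r)) :
    ∃ R : M3, R * Rᴴ = 1 ∧ congrMap R swapMat = swapMat ∧
      congrMap R k 0 2 = ‖c‖ ∧ congrMap R k 1 2 = 0 := by
  have hpr' : (p : ℂ) * p + r * r = 1 := by
    rw [← Complex.ofReal_one, ← hpr]; push_cast; ring
  have hn : (‖c‖ : ℂ) ≠ 0 := by simpa using hc
  have hcc : c * star c = ‖c‖ * ‖c‖ := by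
    have := Complex.mul_conj' c
    rw [pow_two] at this
    exact this
  have hI := Complex.I_mul_I
  refine ⟨!![p, Complex.I * r, 0; Complex.I * r, p, 0; 0, 0, star c / ‖c‖], ?_, ?_, ?_, ?_⟩
  · ext i j
    fin_cases i <;> fin_cases j <;>
      simp [mul_apply, Fin.sum_univ_three, conjTranspose_apply]
    · linear_combination hpr' - (r : ℂ) * r * hI
    · ring
    · ring
    · linear_combination hpr' - (r : ℂ) * r * hI
    · field_simp
      simp at hcc
      linear_combination hcc
  · ext i j
    fin_cases i <;> fin_cases j <;>
      simp [congrMap_apply, mul_apply, Fin.sum_univ_three, conjTranspose_apply, swapMat]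
    · ring
    · linear_combination hpr' - (r : ℂ) * r * hI
    · linear_combination hpr' - (r : ℂ) * r * hI
    · ring
  · simp [congrMap_apply, mul_apply, Fin.sum_univ_three, conjTranspose_apply, hx, hy]
    field_simp
    simp at hcc
    linear_combination hcc * (p ^ 2 - Complex.I ^ 2 * r ^ 2)
      + (‖c‖ : ℂ) ^ 2 * (hpr' - (r : ℂ) * r * hI)
  · simp [congrMap_apply, mul_apply, Fin.sum_univ_three, conjTranspose_apply, hx, hy]
    left
    ring

lemma determined_of_swapMat_mem {W : Submodule ℝ M3} (hW : TracelessSingular W)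
    (hs : swapMat ∈ W) (hc : ¬ Confocal W) : Determined W := by
  by_cases hP : ∀ A ∈ W, A 0 2 = 0 ∧ A 1 2 = 0
  · have hpl : ∀ A ∈ W, IsPlanar A := fun A hA =>
      ⟨(hW A hA).1, (hW.relations hs hA).2.1, (hW.relations hs hA).1, hP A hA⟩
    refine determined_of_planar hs hpl ?_
    by_contra! hex
    exact hc (confocal_of_planar fun A => ⟨hpl A, hex A⟩)
  · push Not at hP
    obtain ⟨k, hk, hne⟩ := hP
    obtain ⟨p, r, c, hpr, hc0, hx, hy⟩ :=
      exists_rotation_parameters (hW.relations hs hk).2.2.1 hne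
    obtain ⟨R, hR, hRs, hRx, hRy⟩ := exists_aligning_unitary hpr hc0 hx hy
    have hn : (‖c‖ : ℂ) ≠ 0 := by simpa using hc0
    refine Determined.of_map hR (determined_of_aligned (hW.map hR)
      (hRs ▸ Submodule.mem_map_of_mem hs)
      (Submodule.smul_mem _ ‖c‖⁻¹ (Submodule.mem_map_of_mem hk)) ?_ ?_)
    · simp [hRx, hn]
    · simp [hRy]

open scoped ComplexOrder in
lemma qf_eq_zero {g : M3} (hg : g.IsHermitian) (h : ∀ v, qf g v = 0) : g = 0 := by
  by_contra h0
  obtain ⟨v, t, ht, hv, hgv⟩ := hg.exists_eigenvector_of_ne_zero h0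
  have := h v
  rw [qf, hgv, dotProduct_smul] at this
  simp [ht] at this
  exact hv (this)

/-- The analogue of the main theorem for a positive definite form in place of `herm`. -/
theorem TracelessSingular.determined {W : Submodule ℝ M3} (hW : TracelessSingular W)
    (hc : ¬ Confocal W) : Determined W := by
  by_cases h0 : W = ⊥
  · subst h0
    intro g hg hv
    rw [Submodule.mem_bot]
    exact qf_eq_zero hg fun v => hv v fun A hA => by
      rw [Submodule.mem_bot] at hA
      simp [hA, qf]
  · obtain ⟨A, hA, hne⟩ := W.exists_mem_ne_zero_of_ne_bot h0
    obtain ⟨h1, h2, h3⟩ := hW A hA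
    obtain ⟨U, r, hU, hr, hUA⟩ := exists_unitary_congr h1 h2 h3 hne
    refine Determined.of_map hU (determined_of_swapMat_mem (hW.map hU) ?_
      fun h => hc (h.of_map hU))
    have := Submodule.smul_mem _ r⁻¹ (Submodule.mem_map_of_mem (f := congrMap U) hA)
    rwa [hUA, smul_smul, inv_mul_cancel₀ hr, one_smul] at this

/-- The Gram matrix of `herm`. -/
def signMat : M3 := diagonal ![1, 1, -1]

lemma signMat_mul_self : signMat * signMat = 1 := by
  ext i j; fin_cases i <;> fin_cases j <;> simp [signMat]

lemma star_dotProduct_signMat (x y : V3) : star y ⬝ᵥ (signMat *ᵥ x) = herm x y := by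
  simp [dotProduct, signMat, mulVec_diagonal, Fin.sum_univ_three, herm]
  ring

lemma signature_inequality {a z : ℂ} {q s u w : ℝ} (hs : 0 ≤ s) (hw : 0 ≤ w)
    (huw : w < u) (ha : ‖a‖ ≤ q * w) (hz : ‖z‖ = s * u) (hpos : 0 < q ^ 2 + s ^ 2) :
    0 < (u ^ 2 - w ^ 2) * (q ^ 2 - s ^ 2) + 2 * ‖a + z‖ ^ 2 := by
  rcases le_or_gt (q * w) (s * u) with h | h
  · have h1 : s * u - q * w ≤ ‖a + z‖ := by
      have := norm_sub_norm_le z (-a)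
      rw [norm_neg, sub_neg_eq_add, add_comm z a] at this
      linarith
    have h2 : (s * u - q * w) ^ 2 ≤ ‖a + z‖ ^ 2 := pow_le_pow_left₀ (by linarith) h1 2
    have h3 : 0 < (u - w) ^ 2 * (q ^ 2 + s ^ 2) := mul_pos (pow_pos (by linarith) 2) hpos
    have h4 : 0 ≤ 2 * (u * w) * (q - s) ^ 2 :=
      mul_nonneg (mul_nonneg (by norm_num) (mul_nonneg (by linarith) hw)) (sq_nonneg _)
    linarith
  · have h1 : s < q := by
      by_contra! hle
      nlinarith [mul_le_mul hle huw.le hw hs]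
    have h2 : 0 < (u ^ 2 - w ^ 2) * (q ^ 2 - s ^ 2) :=
      mul_pos (by nlinarith) (by nlinarith)
    positivity

lemma herm_self (v : V3) : herm v v = ((‖v 0‖ ^ 2 + ‖v 1‖ ^ 2 - ‖v 2‖ ^ 2 : ℝ) : ℂ) := by
  simp only [herm, Complex.mul_conj']
  push_cast
  rfl

lemma herm_self_add_pos {v x : V3} (hv : (herm v v).re < 0) (hx : x ≠ 0) :
    0 < -(herm v v).re * (herm x x).re + 2 * ‖star x ⬝ᵥ v‖ ^ 2 := by
  rw [herm_self, Complex.ofReal_re] at hv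
  rw [herm_self, herm_self, Complex.ofReal_re, Complex.ofReal_re]
  have hw2 : 0 ≤ ‖v 0‖ ^ 2 + ‖v 1‖ ^ 2 := by positivity
  have hq2 : 0 ≤ ‖x 0‖ ^ 2 + ‖x 1‖ ^ 2 := by positivity
  have hwu : √(‖v 0‖ ^ 2 + ‖v 1‖ ^ 2) < ‖v 2‖ := by
    rw [Real.sqrt_lt' (norm_pos_iff.mpr fun h => by rw [h, norm_zero] at hv; linarith)]
    linarith
  have ha : ‖star (x 0) * v 0 + star (x 1) * v 1‖ ≤
      √(‖x 0‖ ^ 2 + ‖x 1‖ ^ 2) * √(‖v 0‖ ^ 2 + ‖v 1‖ ^ 2) := by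
    rw [← Real.sqrt_mul hq2]
    apply Real.le_sqrt_of_sq_le
    refine (pow_le_pow_left₀ (norm_nonneg _) (norm_add_le _ _) 2).trans ?_
    rw [norm_mul, norm_mul, norm_star, norm_star]
    nlinarith [sq_nonneg (‖x 0‖ * ‖v 1‖ - ‖x 1‖ * ‖v 0‖)]
  have hpos : 0 < √(‖x 0‖ ^ 2 + ‖x 1‖ ^ 2) ^ 2 + ‖x 2‖ ^ 2 := by
    rw [Real.sq_sqrt hq2]
    by_contra! h
    apply hx
    ext i
    rw [Pi.zero_apply, ← norm_eq_zero]
    fin_cases i <;> simp only [Fin.zero_eta, Fin.mk_one, Fin.reduceFinMk] <;>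
      nlinarith [sq_nonneg ‖x 0‖, sq_nonneg ‖x 1‖, sq_nonneg ‖x 2‖]
  have := signature_inequality (norm_nonneg (x 2)) (Real.sqrt_nonneg _) hwu ha
    (z := star (x 2) * v 2) (by rw [norm_mul, norm_star]) hpos
  rw [Real.sq_sqrt hq2, Real.sq_sqrt hw2] at this
  simp only [dotProduct, Fin.sum_univ_three, Pi.star_apply]
  linarith

open scoped MatrixOrder ComplexOrder in
/-- For negative `v`, adding a suitable multiple of `v v*` to the matrix of the form makes it
positive definite, hence equal to `C C*`. -/
lemma exists_trace_factor {v : V3} (hv : (herm v v).re < 0) : ∃ (C D : M3) (c : ℝ), C * D = 1 ∧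
    C * Cᴴ = signMat + c • vecMulVec v (star v) := by
  set n := -(herm v v).re with hn
  have hn0 : 0 < n := by linarith
  have hJ : signMat.IsHermitian := by
    ext i j; fin_cases i <;> fin_cases j <;> simp [signMat]
  have hV : (vecMulVec v (star v)).IsHermitian := by
    ext i j; simp [vecMulVec_apply, mul_comm]
  have hS : (signMat + (2 / n) • vecMulVec v (star v)).PosDef := by
    refine .of_dotProduct_mulVec_pos (hJ.add (hV.smul (IsSelfAdjoint.all _))) fun x hx => ?_
    have e : star x ⬝ᵥ (signMat + (2 / n) • vecMulVec v (star v)) *ᵥ x =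
        (((n * (herm x x).re + 2 * ‖star x ⬝ᵥ v‖ ^ 2) / n : ℝ) : ℂ) := by
      have h1 : star v ⬝ᵥ x = star (star x ⬝ᵥ v) := by
        rw [star_dotProduct]
      have h2 : ((herm x x).re : ℂ) = herm x x := by rw [herm_self, Complex.ofReal_re]
      have h3 : (star x ⬝ᵥ v) * star (star x ⬝ᵥ v) = (‖star x ⬝ᵥ v‖ : ℂ) ^ 2 := Complex.mul_conj' _
      have hnC : (n : ℂ) ≠ 0 := by exact_mod_cast hn0.ne'
      rw [add_mulVec, smul_mulVec, vecMulVec_mulVec, dotProduct_add, star_dotProduct_signMat,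
        dotProduct_smul, h1]
      push_cast
      rw [h2, ← h3]
      simp [dotProduct_smul]
      field_simp
    rw [e, Complex.zero_lt_real]
    exact div_pos (herm_self_add_pos hv hx) hn0
  obtain ⟨b, hb⟩ := CStarAlgebra.nonneg_iff_eq_mul_star_self.mp hS.posSemidef.nonneg
  have hdet := hS.det_pos.ne'
  rw [hb, det_mul] at hdet
  exact ⟨b, b⁻¹, 2 / n, mul_nonsing_inv _ (isUnit_iff_ne_zero.mpr (left_ne_zero_of_mul hdet)),
    hb.symm⟩

/-- The matrix of the form `⟨h x, y⟩`. -/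
def gramMap : Module.End ℂ V3 →ₗ[ℝ] M3 where
  toFun h := signMat * LinearMap.toMatrix' h
  map_add' g h := by rw [map_add, mul_add]
  map_smul' r h := by
    ext i j
    simp [signMat, LinearMap.toMatrix'_apply, diagonal_mul]
    ring

lemma gramMap_apply (h : Module.End ℂ V3) : gramMap h = signMat * LinearMap.toMatrix' h := rfl

lemma signMat_mul_gramMap (h : Module.End ℂ V3) :
    signMat * gramMap h = LinearMap.toMatrix' h := by
  rw [gramMap_apply, ← mul_assoc, signMat_mul_self, one_mul]

lemma gramMap_injective : Function.Injective gramMap := fun g h hgh =>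
  LinearMap.toMatrix'.injective (by rw [← signMat_mul_gramMap, hgh, signMat_mul_gramMap])

lemma star_dotProduct_gramMap (h : Module.End ℂ V3) (x y : V3) :
    star y ⬝ᵥ (gramMap h *ᵥ x) = herm (h x) y := by
  rw [gramMap_apply, ← mulVec_mulVec, star_dotProduct_signMat, LinearMap.toMatrix'_mulVec]

lemma herm_conj_symm (x y : V3) : star (herm x y) = herm y x := by
  simp [herm]
  ring

lemma SelfAdj.gramMap_isHermitian {h : Module.End ℂ V3} (hh : SelfAdj h) :
    (gramMap h).IsHermitian := by
  ext i j
  have key : ∀ a b, gramMap h a b = herm (h (Pi.single b 1)) (Pi.single a 1) := fun a b => by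
    rw [← star_dotProduct_gramMap]; simp
  rw [conjTranspose_apply, key, key, herm_conj_symm, hh]

lemma trace_signMat_mul_gramMap (h : Module.End ℂ V3) :
    (gramMap h * signMat).trace = LinearMap.trace ℂ V3 h := by
  rw [trace_mul_comm, signMat_mul_gramMap, LinearMap.trace_eq_matrix_trace ℂ (Pi.basisFun ℂ (Fin 3)),
    LinearMap.toMatrix_eq_toMatrix']

lemma trace_congrMap_gramMap {C : M3} {c : ℝ} {v : V3}
    (hC : C * Cᴴ = signMat + c • vecMulVec v (star v)) (h : Module.End ℂ V3) :
    (congrMap C (gramMap h)).trace = LinearMap.trace ℂ V3 h + c * herm (h v) v := by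
  rw [congrMap_apply, trace_mul_comm, ← mul_assoc, hC, trace_mul_comm, mul_add, trace_add,
    trace_signMat_mul_gramMap, Matrix.mul_smul, trace_smul, mul_vecMulVec, trace_vecMulVec,
    dotProduct_comm, star_dotProduct_gramMap, Complex.real_smul]

lemma det_gramMap {h : Module.End ℂ V3} (hh : LinearMap.det h = 0) : (gramMap h).det = 0 := by
  rw [gramMap_apply, det_mul, LinearMap.det_toMatrix', hh, mul_zero]

/-- except for confocal `3`- or `4`-dimensional families with negative
common focus, a linear family of bisectors is determined by its base. -/
theorem stmt_2 (W : Submodule ℝ (Module.End ℂ V3)) (hW : IsLinearFamily W)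
    (hexc : ¬ (3 ≤ Module.finrank ℝ W ∧
      ∃ f₀ : V3, f₀ ≠ 0 ∧ (herm f₀ f₀).re < 0 ∧ ∀ h ∈ W, h f₀ = 0)) :
    (W : Set (Module.End ℂ V3)) =
      {h : Module.End ℂ V3 | LinearMap.trace ℂ V3 h = 0 ∧ SelfAdj h ∧
        ∀ v : V3, v ≠ 0 → (∀ g ∈ W, herm (g v) v = 0) → herm (h v) v = 0} := by
  obtain ⟨hW, v, hv0, hneg, hv⟩ := hW
  obtain ⟨C, D, c, hCD, hC⟩ := exists_trace_factor hneg
  have hqf : ∀ h u, qf (gramMap h) u = herm (h u) u := fun h u => star_dotProduct_gramMap h u u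
  have hTS : TracelessSingular ((W.map gramMap).map (congrMap C)) := by
    rintro _ ⟨_, ⟨h, hh, rfl⟩, rfl⟩
    obtain ⟨hs, ht, hd⟩ := hW h hh
    refine ⟨isHermitian_conjTranspose_mul_mul C hs.gramMap_isHermitian, ?_, ?_⟩
    · rw [trace_congrMap_gramMap hC, ht, hv h hh, mul_zero, add_zero]
    · rw [congrMap_apply, det_mul, det_mul, det_gramMap hd, mul_zero, zero_mul]
  have hcf : ¬ Confocal ((W.map gramMap).map (congrMap C)) := by
    intro hcon
    obtain ⟨h3, f, hf, hbase⟩ := hcon.of_map hCD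
    rw [← (Submodule.equivMapOfInjective _ gramMap_injective W).finrank_eq] at h3
    obtain ⟨a, rfl⟩ := hbase v (by
      rintro _ ⟨h, hh, rfl⟩
      rw [hqf, hv h hh])
    refine hexc ⟨h3, a • f, hv0, hneg, fun h hh => ?_⟩
    have := congrArg (signMat *ᵥ ·) (hf _ (Submodule.mem_map_of_mem hh))
    simp only [mulVec_mulVec, signMat_mul_gramMap, LinearMap.toMatrix'_mulVec, mulVec_zero] at this
    rw [map_smul, this, smul_zero]
  have hdet : Determined (W.map gramMap) := (hTS.determined hcf).of_map hCD
  ext g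
  refine ⟨fun hg => ⟨(hW g hg).2.1, (hW g hg).1, fun u _ hu => hu g hg⟩, ?_⟩
  rintro ⟨-, hgs, hg⟩
  obtain ⟨h, hh, hhg⟩ := hdet (gramMap g) hgs.gramMap_isHermitian fun u hu => by
    rw [hqf]
    by_cases hu0 : u = 0
    · simp [hu0, herm]
    · exact hg u hu0 fun k hk => by
        rw [← hqf]; exact hu _ (Submodule.mem_map_of_mem hk)
  rwa [← gramMap_injective hhg]

end
end
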